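/- arXiv:1409.5661 — 6 statements merged into one kernel-verified Lean document; each statement's English description precedes it below -/
import Mathlib

section
/- For every ε > 0 there exist δ > 0 and N such that for all n ≥ N the following holds: if A ⊆ [n] contains at most δn² Schur triples, (1/2 − 1/11)n ≤ |A| ≤ (1/2 + ε)n, and the number of elements a ∈ A with a ≤ |A| is at most δn, then the number of maximal sum-free subsets of [n] that are contained in A is at most 2^{(1/4 + ε)n}. -/
/-- A set of naturals is sum-free: no `x, y ∈ S` (not necessarily distinct) with `x + y ∈ S`. -/
def SumFree (S : Finset ℕ) : Prop := ∀ x ∈ S, ∀ y ∈ S, x + y ∉ S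

/-- `S` is a maximal sum-free subset of `[n] = {1, …, n}`. -/
def IsMaxSumFree (n : ℕ) (S : Finset ℕ) : Prop :=
  S ⊆ Finset.Icc 1 n ∧ SumFree S ∧
    ∀ T : Finset ℕ, T ⊆ Finset.Icc 1 n → SumFree T → S ⊆ T → S = T

/-- The number of Schur triples in `A`: pairs `(x, y) ∈ A × A` with `x + y ∈ A`. -/
def schurTriples (A : Finset ℕ) : ℕ :=
  ((A ×ˢ A).filter (fun p => p.1 + p.2 ∈ A)).card

/-- The number of maximal sum-free subsets of `[n]` that are contained in `A`. -/
noncomputable def fmaxIn (n : ℕ) (A : Finset ℕ) : ℕ :=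
  {S : Finset ℕ | IsMaxSumFree n S ∧ S ⊆ A}.ncard

open scoped Classical in
/-- The maximal independent subsets of `W` in the graph `G`, as those subsets of `W` that contain
exactly the vertices of `W` without a neighbour in them. -/
noncomputable def maxIndepSets {α : Type*} (G : SimpleGraph α) (W : Finset α) :
    Finset (Finset α) :=
  W.powerset.filter fun I => ∀ w ∈ W, w ∈ I ↔ ∀ x ∈ I, ¬ G.Adj w x

section MaxIndepSets

open Finset
open scoped Classical

variable {α : Type*} {G : SimpleGraph α}

theorem mem_maxIndepSets {W I : Finset α} :
    I ∈ maxIndepSets G W ↔ I ⊆ W ∧ ∀ w ∈ W, w ∈ I ↔ ∀ x ∈ I, ¬ G.Adj w x := by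
  simp [maxIndepSets]

theorem not_adj_of_mem_maxIndepSets {W I : Finset α} (hI : I ∈ maxIndepSets G W) {x y : α}
    (hx : x ∈ I) (hy : y ∈ I) : ¬ G.Adj x y :=
  have h := mem_maxIndepSets.1 hI
  (h.2 x (h.1 hx)).1 hx y hy

theorem exists_adj_of_notMem_maxIndepSets {W I : Finset α} (hI : I ∈ maxIndepSets G W) {w : α}
    (hw : w ∈ W) (hwI : w ∉ I) : ∃ x ∈ I, G.Adj w x := by
  by_contra! h
  exact hwI (((mem_maxIndepSets.1 hI).2 w hw).2 h)

/-- Maximal independent sets containing `K` correspond injectively to maximal independent sets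
of the graph with the closed neighbourhood of `K` deleted. -/
theorem card_maxIndepSets_superset_le (W K : Finset α) :
    #{I ∈ maxIndepSets G W | K ⊆ I} ≤
      #(maxIndepSets G {w ∈ W | ∀ k ∈ K, w ≠ k ∧ ¬ G.Adj k w}) := by
  refine card_le_card_of_injOn (· \ K) ?_ ?_
  · intro I hI
    obtain ⟨hI, hK⟩ := mem_filter.1 (mem_coe.1 hI)
    refine mem_coe.2
      (mem_maxIndepSets.2 ⟨fun x hx => ?_, fun w hw => ⟨fun h x hx => ?_, fun h => ?_⟩⟩)
    · obtain ⟨hx, hxK⟩ := mem_sdiff.1 hx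
      refine mem_filter.2 ⟨(mem_maxIndepSets.1 hI).1 hx, fun k hk => ⟨?_, ?_⟩⟩
      · rintro rfl
        exact hxK hk
      · exact not_adj_of_mem_maxIndepSets hI (hK hk) hx
    · exact not_adj_of_mem_maxIndepSets hI (mem_sdiff.1 h).1 (mem_sdiff.1 hx).1
    · obtain ⟨hw, hwK⟩ := mem_filter.1 hw
      refine mem_sdiff.2 ⟨?_, fun hk => (hwK w hk).1 rfl⟩
      by_contra hwI
      obtain ⟨x, hx, hwx⟩ := exists_adj_of_notMem_maxIndepSets hI hw hwI
      by_cases hxK : x ∈ K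
      · exact (hwK x hxK).2 hwx.symm
      · exact h x (mem_sdiff.2 ⟨hx, hxK⟩) hwx
  · intro I hI J hJ h
    have hI := (mem_filter.1 (mem_coe.1 hI)).2
    have hJ := (mem_filter.1 (mem_coe.1 hJ)).2
    rw [← sdiff_union_of_subset hI, ← sdiff_union_of_subset hJ]
    exact congrArg (· ∪ K) h

theorem natCast_le_sqrt_two_pow {k : ℕ} (hk : k ≠ 3) : (k : ℝ) ≤ √2 ^ k := by
  have key : k ^ 2 ≤ 2 ^ k := by
    rcases Nat.lt_or_ge k 4 with h | h
    · interval_cases k <;> simp_all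
    · induction k, h using Nat.le_induction with
      | base => norm_num
      | succ m hm ih =>
        have := ih (by omega)
        rw [pow_succ 2 m]
        nlinarith
  refine (sq_le_sq₀ (by positivity) (by positivity)).1 ?_
  rw [← pow_mul, mul_comm, pow_mul, Real.sq_sqrt zero_le_two]
  exact_mod_cast key

/-- The Hujter–Tuza bound: a triangle-free graph on `m` vertices has at most `2 ^ (m / 2)` maximal
independent sets. -/
theorem card_maxIndepSets_le_of_triangleFree
    (hG : ∀ a b c, G.Adj a b → G.Adj a c → ¬ G.Adj b c) (W : Finset α) :
    (#(maxIndepSets G W) : ℝ) ≤ √2 ^ #W := by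
  induction hn : #W using Nat.strong_induction_on generalizing W with
  | _ n ih =>
  subst hn
  have hc0 : (0 : ℝ) < √2 := by positivity
  have hc1 : (1 : ℝ) ≤ √2 := Real.one_le_sqrt.2 one_le_two
  have hsq : √2 ^ 2 = (2 : ℝ) := Real.sq_sqrt zero_le_two
  rcases W.eq_empty_or_nonempty with rfl | hW
  · simp [maxIndepSets]
  have branch : ∀ (K D : Finset α) (d : ℕ), 0 < d → d ≤ #D → D ⊆ W →
      (∀ x ∈ D, ∃ k ∈ K, x = k ∨ G.Adj k x) →
      (#{I ∈ maxIndepSets G W | K ⊆ I} : ℝ) * √2 ^ d ≤ √2 ^ #W := by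
    intro K D d hd hdD hDW hD
    set R := {w ∈ W | ∀ k ∈ K, w ≠ k ∧ ¬ G.Adj k w} with hR
    have hRD : R ⊆ W \ D := by
      intro w hw
      obtain ⟨hwW, hwK⟩ := mem_filter.1 hw
      refine mem_sdiff.2 ⟨hwW, fun hwD => ?_⟩
      obtain ⟨k, hk, h⟩ := hD w hwD
      exact h.elim (hwK k hk).1 (hwK k hk).2
    have hcard : #R + d ≤ #W := by
      have h1 := card_le_card hRD
      have h2 := card_sdiff_add_card_eq_card hDW
      omega
    calc (#{I ∈ maxIndepSets G W | K ⊆ I} : ℝ) * √2 ^ d ≤ √2 ^ #R * √2 ^ d := by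
          gcongr
          exact (Nat.cast_le.2 (card_maxIndepSets_superset_le W K)).trans
            (ih #R (by omega) R rfl)
      _ = √2 ^ (#R + d) := (pow_add _ _ _).symm
      _ ≤ √2 ^ #W := pow_le_pow_right₀ hc1 hcard
  let N : α → Finset α := fun v => {w ∈ W | G.Adj v w}
  have hN : ∀ {v w}, w ∈ N v ↔ w ∈ W ∧ G.Adj v w := mem_filter
  have hNcard : ∀ v, #(insert v (N v)) = #(N v) + 1 := fun v =>
    card_insert_of_notMem fun h => G.loopless.irrefl v (hN.1 h).2
  have branch_single : ∀ u ∈ W, ∀ d, 0 < d → d ≤ #(N u) + 1 →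
      (#{I ∈ maxIndepSets G W | {u} ⊆ I} : ℝ) * √2 ^ d ≤ √2 ^ #W := by
    intro u hu d hd hdu
    refine branch {u} (insert u (N u)) d hd (by rwa [hNcard]) ?_ ?_
    · exact insert_subset hu (filter_subset _ _)
    · intro x hx
      refine ⟨u, mem_singleton_self u, ?_⟩
      exact (mem_insert.1 hx).imp_right fun h => (hN.1 h).2
  obtain ⟨v, hvW, hmin⟩ := exists_min_image W (fun v => #(N v)) hW
  have dominated : ∀ I ∈ maxIndepSets G W, ∀ w ∈ W, w ∉ I → ∃ u ∈ N w, u ∈ I := by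
    intro I hI w hw hwI
    obtain ⟨x, hx, hwx⟩ := exists_adj_of_notMem_maxIndepSets hI hw hwI
    exact ⟨x, hN.2 ⟨(mem_maxIndepSets.1 hI).1 hx, hwx⟩, hx⟩
  by_cases hdeg : #(N v) = 2
  swap
  · have hcover : maxIndepSets G W ⊆
        (insert v (N v)).biUnion fun u => {I ∈ maxIndepSets G W | {u} ⊆ I} := by
      intro I hI
      by_cases hvI : v ∈ I
      · exact mem_biUnion.2 ⟨v, mem_insert_self _ _, by simp [hI, hvI]⟩
      · obtain ⟨u, hu, huI⟩ := dominated I hI v hvW hvI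
        exact mem_biUnion.2 ⟨u, mem_insert_of_mem hu, by simp [hI, huI]⟩
    have hle : (#(maxIndepSets G W) : ℝ) ≤
        ∑ u ∈ insert v (N v), (#{I ∈ maxIndepSets G W | {u} ⊆ I} : ℝ) := by
      exact_mod_cast (card_le_card hcover).trans card_biUnion_le
    refine le_of_mul_le_mul_right ?_ (pow_pos hc0 (#(N v) + 1))
    calc (#(maxIndepSets G W) : ℝ) * √2 ^ (#(N v) + 1)
        ≤ (∑ u ∈ insert v (N v), (#{I ∈ maxIndepSets G W | {u} ⊆ I} : ℝ)) *
            √2 ^ (#(N v) + 1) := by gcongr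
      _ = ∑ u ∈ insert v (N v), (#{I ∈ maxIndepSets G W | {u} ⊆ I} : ℝ) *
            √2 ^ (#(N v) + 1) := sum_mul _ _ _
      _ ≤ ∑ _u ∈ insert v (N v), √2 ^ #W := by
          refine sum_le_sum fun u hu => ?_
          have huW : u ∈ W := by
            rcases mem_insert.1 hu with rfl | h
            exacts [hvW, (hN.1 h).1]
          exact branch_single u huW _ (Nat.succ_pos _) (Nat.succ_le_succ (hmin u huW))
      _ = √2 ^ #W * (#(N v) + 1 : ℕ) := by
          rw [sum_const, hNcard, nsmul_eq_mul, mul_comm]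
      _ ≤ √2 ^ #W * √2 ^ (#(N v) + 1) := by
          gcongr
          exact natCast_le_sqrt_two_pow (by omega)
  · obtain ⟨a, b, hab, hNv⟩ := card_eq_two.1 hdeg
    obtain ⟨haW, hva⟩ := hN.1 (hNv ▸ mem_insert_self a {b} : a ∈ N v)
    obtain ⟨hbW, hvb⟩ := hN.1 (hNv ▸ by simp : b ∈ N v)
    have hda := hmin a haW
    have hdb := hmin b hbW
    simp only [hdeg] at hda hdb
    have hv3 := branch_single v hvW 3 (by norm_num) (by omega)
    have hcover : ∀ K : Finset α, (∀ I ∈ maxIndepSets G W, v ∉ I → a ∉ I → b ∈ I → K ⊆ I) →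
        (#(maxIndepSets G W) : ℝ) ≤ #{I ∈ maxIndepSets G W | {v} ⊆ I} +
          #{I ∈ maxIndepSets G W | {a} ⊆ I} + #{I ∈ maxIndepSets G W | K ⊆ I} := by
      intro K hK
      have hsub : maxIndepSets G W ⊆ ({I ∈ maxIndepSets G W | {v} ⊆ I} ∪
          {I ∈ maxIndepSets G W | {a} ⊆ I}) ∪ {I ∈ maxIndepSets G W | K ⊆ I} := by
        intro I hI
        simp only [mem_union, mem_filter, hI, true_and, singleton_subset_iff]
        by_contra! h
        obtain ⟨⟨hvI, haI⟩, hKI⟩ := h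
        obtain ⟨u, hu, huI⟩ := dominated I hI v hvW hvI
        simp only [hNv, mem_insert, mem_singleton] at hu
        rcases hu with rfl | rfl
        exacts [haI huI, hKI (hK I hI hvI haI huI)]
      exact_mod_cast (card_le_card hsub).trans
        ((card_union_le _ _).trans (Nat.add_le_add_right (card_union_le _ _) _))
    have hc14 : (1.4 : ℝ) ≤ √2 := Real.le_sqrt_of_sq_le (by norm_num)
    have hcube : √2 ^ 3 = 2 * √2 := by rw [pow_succ, hsq]
    have hT : 0 < √2 ^ #W := by positivity
    by_cases ha3 : 3 ≤ #(N a)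
    · have h := hcover {b} (fun I _ _ _ hbI => singleton_subset_iff.2 hbI)
      have ha4 := branch_single a haW 4 (by norm_num) (by omega)
      have hb3 := branch_single b hbW 3 (by norm_num) (by omega)
      have hfour : √2 ^ 4 = 4 := by rw [show 4 = 2 * 2 from rfl, pow_mul, hsq]; norm_num
      rw [hcube] at hv3 hb3
      rw [hfour] at ha4
      refine le_of_mul_le_mul_right ?_ (show 0 < 4 * √2 by positivity)
      nlinarith
    · have ha3' := branch_single a haW 3 (by norm_num) (by omega)
      obtain ⟨a', ha'N, ha'v⟩ := exists_mem_ne (by omega : 1 < #(N a)) v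
      obtain ⟨b', hb'N, hb'v⟩ := exists_mem_ne (by omega : 1 < #(N b)) v
      obtain ⟨ha'W, haa'⟩ := hN.1 ha'N
      obtain ⟨hb'W, hbb'⟩ := hN.1 hb'N
      have hNa : N a = {v, a'} := by
        refine (eq_of_subset_of_card_le ?_ ?_).symm
        · exact insert_subset (hN.2 ⟨hvW, hva.symm⟩) (singleton_subset_iff.2 ha'N)
        · rw [card_pair ha'v.symm]; omega
      have h := hcover {a', b} (by
        intro I hI hvI haI hbI
        obtain ⟨u, hu, huI⟩ := dominated I hI a haW haI
        simp only [hNa, mem_insert, mem_singleton] at hu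
        rcases hu with rfl | rfl
        · exact absurd huI hvI
        · exact insert_subset huI (singleton_subset_iff.2 hbI))
      have h5 : (#{I ∈ maxIndepSets G W | {a', b} ⊆ I} : ℝ) * √2 ^ 5 ≤ √2 ^ #W := by
        by_cases hadj : G.Adj a' b
        · have hempty : {I ∈ maxIndepSets G W | {a', b} ⊆ I} = ∅ := by
            refine filter_eq_empty_iff.2 fun I hI hsub => ?_
            exact not_adj_of_mem_maxIndepSets hI (hsub (by simp)) (hsub (by simp)) hadj
          rw [hempty]
          simp
        · have hnab : ¬ G.Adj a b := hG v a b hva hvb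
          refine branch {a', b} {a, a', b, b', v} 5 (by norm_num) ?_ ?_ ?_
          · have h1 : a ≠ a' := haa'.ne
            have h2 : a ≠ b' := fun e => hnab (e ▸ hbb'.symm)
            have h3 : a' ≠ b := fun e => hnab (e ▸ haa')
            have h4 : a' ≠ b' := fun e => hadj (e ▸ hbb'.symm)
            have h5 := hbb'.ne
            have h6 := hva.ne'
            have h7 := hvb.ne'
            refine le_of_eq (Eq.symm ?_)
            simp [card_insert_of_notMem, *]
          · simp [insert_subset_iff, *]
          · intro x hx
            simp only [mem_insert, mem_singleton] at hx
            rcases hx with rfl | rfl | rfl | rfl | rfl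
            · exact ⟨a', by simp, Or.inr haa'.symm⟩
            · exact ⟨x, by simp, Or.inl rfl⟩
            · exact ⟨x, by simp, Or.inl rfl⟩
            · exact ⟨b, by simp, Or.inr hbb'⟩
            · exact ⟨b, by simp, Or.inr hvb.symm⟩
      have hfive : √2 ^ 5 = 4 * √2 := by
        rw [pow_succ, show 4 = 2 * 2 from rfl, pow_mul, hsq]; norm_num
      rw [hcube] at hv3 ha3'
      rw [hfive] at h5
      refine le_of_mul_le_mul_right ?_ (show 0 < 4 * √2 by positivity)
      nlinarith

end MaxIndepSets

section SumFree

open Finset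
open scoped Classical

/-- The graph on `ℕ` joining two numbers that differ by an element of `S`. -/
def differenceGraph (S : Finset ℕ) : SimpleGraph ℕ :=
  SimpleGraph.fromRel fun x y => ∃ s ∈ S, x + s = y

theorem SumFree.mono {S T : Finset ℕ} (hT : SumFree T) (h : S ⊆ T) : SumFree S :=
  fun x hx y hy hxy => hT x (h hx) y (h hy) (h hxy)

theorem SumFree.differenceGraph_triangleFree {S : Finset ℕ} (hS : SumFree S) (a b c : ℕ)
    (hab : (differenceGraph S).Adj a b) (hac : (differenceGraph S).Adj a c) :
    ¬ (differenceGraph S).Adj b c := by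
  intro hbc
  have key : ∀ r ∈ S, ∀ s ∈ S, ∀ t ∈ S, r + s ≠ t := fun r hr s hs t ht e =>
    hS r hr s hs (e ▸ ht)
  simp only [differenceGraph, SimpleGraph.fromRel_adj] at hab hac hbc
  obtain ⟨-, ⟨r, hr, hab⟩ | ⟨r, hr, hab⟩⟩ := hab <;>
  obtain ⟨-, ⟨s, hs, hac⟩ | ⟨s, hs, hac⟩⟩ := hac <;>
  obtain ⟨-, ⟨t, ht, hbc⟩ | ⟨t, ht, hbc⟩⟩ := hbc <;>
  have h1 := key r hr s hs t ht <;> have h2 := key r hr t ht s hs <;>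
  have h3 := key s hs t ht r hr <;>
  grind

/-- The elements of a maximal sum-free set in `(n / 2, n]` form a maximal independent set in the
difference graph of its remaining elements. -/
theorem IsMaxSumFree.filter_mem_maxIndepSets {n : ℕ} {A M : Finset ℕ} (hA : A ⊆ Icc 1 n)
    (hM : IsMaxSumFree n M) (hMA : M ⊆ A) :
    {x ∈ M | n < 2 * x} ∈ maxIndepSets (differenceGraph {x ∈ M | ¬ n < 2 * x})
      {u ∈ A | n < 2 * u ∧ SumFree (insert u {x ∈ M | ¬ n < 2 * x})} := by
  obtain ⟨-, hsf, hmax⟩ := hM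
  refine mem_maxIndepSets.2 ⟨fun x hx => ?_, fun w hw => ⟨fun h x hx hwx => ?_, fun h => ?_⟩⟩
  · obtain ⟨hx, hxn⟩ := mem_filter.1 hx
    exact mem_filter.2 ⟨hMA hx, hxn, hsf.mono (insert_subset hx (filter_subset _ _))⟩
  · have hw := (mem_filter.1 h).1
    have hx := (mem_filter.1 hx).1
    obtain ⟨-, ⟨s, hs, e⟩ | ⟨s, hs, e⟩⟩ := (SimpleGraph.fromRel_adj _ _ _).1 hwx
    · exact hsf w hw s (mem_filter.1 hs).1 (e ▸ hx)
    · exact hsf x hx s (mem_filter.1 hs).1 (e ▸ hw)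
  · obtain ⟨hwA, hwn, hwS⟩ := mem_filter.1 hw
    refine mem_filter.2 ⟨?_, hwn⟩
    have hins : insert w M ⊆ Icc 1 n := insert_subset (hA hwA) (hMA.trans hA)
    suffices hsf' : SumFree (insert w M) by
      rw [hmax _ hins hsf' (subset_insert _ _)]
      exact mem_insert_self _ _
    have hadj : ∀ u ∈ M, n < 2 * u → ∀ s ∈ M, ¬ n < 2 * s → u + s ≠ w ∧ w + s ≠ u := by
      intro u hu hun s hs hsn
      have hs1 := (mem_Icc.1 (hins (mem_insert_of_mem hs))).1
      have := h u (mem_filter.2 ⟨hu, hun⟩)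
      rw [differenceGraph, SimpleGraph.fromRel_adj] at this
      constructor <;> intro e
      · exact this ⟨by omega, Or.inr ⟨s, mem_filter.2 ⟨hs, hsn⟩, e⟩⟩
      · exact this ⟨by omega, Or.inl ⟨s, mem_filter.2 ⟨hs, hsn⟩, e⟩⟩
    intro p hp q hq hpq
    have hr := mem_Icc.1 (hins hpq)
    have hp1 := mem_Icc.1 (hins hp)
    have hq1 := mem_Icc.1 (hins hq)
    have inM := fun hpM hqM => hsf p hpM q hqM
    have inS := fun hpS hqS => hwS p hpS q hqS
    have adj_pq := hadj p
    have adj_qp := hadj q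
    have adj_rq := hadj (p + q)
    simp only [mem_insert, mem_filter] at hp hq hpq inM inS
    clear hadj hins h hmax hsf hwS hw hA hMA
    by_cases hpn : n < 2 * p
    · have hqn : ¬ n < 2 * q := by omega
      have hrn : n < 2 * (p + q) := by omega
      grind
    · by_cases hqn : n < 2 * q
      · have hrn : n < 2 * (p + q) := by omega
        grind
      · grind

theorem fmaxIn_le {n : ℕ} {A : Finset ℕ} (hA : A ⊆ Icc 1 n) :
    (fmaxIn n A : ℝ) ≤ 2 ^ #{x ∈ A | ¬ n < 2 * x} * √2 ^ #{x ∈ A | n < 2 * x} := by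
  let W : Finset ℕ → Finset ℕ := fun S => {u ∈ A | n < 2 * u ∧ SumFree (insert u S)}
  let 𝒮 : Finset (Finset ℕ) := {S ∈ powerset {x ∈ A | ¬ n < 2 * x} | SumFree S}
  have hcover : {M : Finset ℕ | IsMaxSumFree n M ∧ M ⊆ A} ⊆
      ↑(𝒮.biUnion fun S => (maxIndepSets (differenceGraph S) (W S)).image (· ∪ S)) := by
    rintro M ⟨hM, hMA⟩
    refine mem_coe.2 (mem_biUnion.2 ⟨{x ∈ M | ¬ n < 2 * x}, mem_filter.2 ⟨?_, ?_⟩, ?_⟩)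
    · exact mem_powerset.2 (filter_subset_filter _ hMA)
    · exact hM.2.1.mono (filter_subset _ _)
    · exact mem_image.2 ⟨_, hM.filter_mem_maxIndepSets hA hMA, filter_union_filter_not_eq _ _⟩
  have hcard : fmaxIn n A ≤ ∑ S ∈ 𝒮, #(maxIndepSets (differenceGraph S) (W S)) := by
    refine (Set.ncard_le_ncard hcover (finite_toSet _)).trans ?_
    rw [Set.ncard_coe_finset]
    exact card_biUnion_le.trans (sum_le_sum fun S _ => card_image_le)
  calc (fmaxIn n A : ℝ) ≤ ∑ S ∈ 𝒮, (#(maxIndepSets (differenceGraph S) (W S)) : ℝ) := by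
        exact_mod_cast hcard
    _ ≤ ∑ _S ∈ 𝒮, √2 ^ #{x ∈ A | n < 2 * x} := by
        refine sum_le_sum fun S hS => (card_maxIndepSets_le_of_triangleFree
          (mem_filter.1 hS).2.differenceGraph_triangleFree _).trans ?_
        refine pow_le_pow_right₀ (Real.one_le_sqrt.2 one_le_two) (card_le_card ?_)
        exact monotone_filter_right _ fun _ _ h => h.1
    _ = #𝒮 * √2 ^ #{x ∈ A | n < 2 * x} := by rw [sum_const, nsmul_eq_mul]
    _ ≤ 2 ^ #{x ∈ A | ¬ n < 2 * x} * √2 ^ #{x ∈ A | n < 2 * x} := by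
        gcongr
        exact_mod_cast (card_filter_le _ _).trans (card_powerset _).le

end SumFree

theorem stmt12 :
    ∀ ε : ℝ, 0 < ε → ∃ δ : ℝ, 0 < δ ∧ ∃ N : ℕ, ∀ n : ℕ, N ≤ n →
      ∀ A : Finset ℕ, A ⊆ Finset.Icc 1 n →
        (schurTriples A : ℝ) ≤ δ * n ^ 2 →
        (1 / 2 - 1 / 11 : ℝ) * n ≤ A.card →
        (A.card : ℝ) ≤ (1 / 2 + ε) * n →
        ((A.filter (fun a => a ≤ A.card)).card : ℝ) ≤ δ * n →
        (fmaxIn n A : ℝ) ≤ (2 : ℝ) ^ ((1 / 4 + ε) * n) := by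
  intro ε hε
  refine ⟨ε, hε, 0, fun n _ A hA _ _ hcard hsmall => (fmaxIn_le hA).trans ?_⟩
  set l := (A.filter (fun x => ¬ n < 2 * x)).card
  set u := (A.filter (fun x => n < 2 * x)).card
  have hsum : u + l = A.card := Finset.card_filter_add_card_filter_not _
  have hl : l ≤ (A.filter (fun a => a ≤ A.card)).card + (n / 2 - A.card) := by
    have hsub : A.filter (fun x => ¬ n < 2 * x) ⊆
        A.filter (fun a => a ≤ A.card) ∪ Finset.Ioc A.card (n / 2) := by
      intro x hx
      simp only [Finset.mem_filter, Finset.mem_union, Finset.mem_Ioc] at hx ⊢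
      by_cases h : x ≤ A.card
      · exact Or.inl ⟨hx.1, h⟩
      · exact Or.inr (by omega)
    exact (Finset.card_le_card hsub).trans
      ((Finset.card_union_le _ _).trans_eq (by rw [Nat.card_Ioc]))
  have hexp : (l : ℝ) + u / 2 ≤ (1 / 4 + ε) * n := by
    have hsum' : (u : ℝ) + l = A.card := by exact_mod_cast hsum
    have hn : (0 : ℝ) ≤ ε * n := by positivity
    rcases le_total A.card (n / 2) with h | h
    · have : (2 * (l + A.card) : ℝ) ≤ 2 * (A.filter (fun a => a ≤ A.card)).card + n := by
        exact_mod_cast (by omega :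
          2 * (l + A.card) ≤ 2 * (A.filter (fun a => a ≤ A.card)).card + n)
      linarith
    · have : (l : ℝ) ≤ (A.filter (fun a => a ≤ A.card)).card := by
        exact_mod_cast (by omega : l ≤ (A.filter (fun a => a ≤ A.card)).card)
      linarith
  calc (2 : ℝ) ^ l * √2 ^ u = 2 ^ ((l : ℝ) + u / 2) := by
        rw [Real.rpow_add two_pos, Real.rpow_natCast, Real.sqrt_eq_rpow,
          ← Real.rpow_mul_natCast zero_le_two, one_div_mul_eq_div]
    _ ≤ 2 ^ ((1 / 4 + ε) * n) := Real.rpow_le_rpow_of_exponent_le one_le_two hexp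
end

section
/- For every ε > 0 there exist δ > 0 and N such that for all n ≥ N the following holds: if A ⊆ [n] has at most δn even elements, then the number of maximal sum-free subsets of [n] that are contained in A is at most 2^{(1/4 + ε)n}. -/
/-- The maximal independent sets of the subgraph of `G` induced on `W`. -/
def maxIndep {α : Type*} [DecidableEq α] (G : SimpleGraph α) [DecidableRel G.Adj]
    (W : Finset α) : Finset (Finset α) :=
  W.powerset.filter fun I =>
    (∀ x ∈ I, ∀ y ∈ I, ¬ G.Adj x y) ∧ ∀ v ∈ W, v ∉ I → ∃ u ∈ I, G.Adj v u

section MaxIndep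

variable {α : Type*} [DecidableEq α] (G : SimpleGraph α) [DecidableRel G.Adj]

/-- `W` with the closed neighbourhood of `v` removed. -/
def removeNbhd (W : Finset α) (v : α) : Finset α :=
  W.filter fun w => w ≠ v ∧ ¬ G.Adj v w

variable {G}

lemma mem_maxIndep {W I : Finset α} : I ∈ maxIndep G W ↔
    I ⊆ W ∧ (∀ x ∈ I, ∀ y ∈ I, ¬ G.Adj x y) ∧ ∀ v ∈ W, v ∉ I → ∃ u ∈ I, G.Adj v u := by
  simp [maxIndep]

lemma mem_removeNbhd {W : Finset α} {v w : α} :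
    w ∈ removeNbhd G W v ↔ w ∈ W ∧ w ≠ v ∧ ¬ G.Adj v w := by
  simp [removeNbhd]

lemma removeNbhd_subset (W : Finset α) (v : α) : removeNbhd G W v ⊆ W :=
  Finset.filter_subset _ _

lemma card_removeNbhd {W : Finset α} {v : α} (hv : v ∈ W) :
    (removeNbhd G W v).card + 1 + (W.filter (G.Adj v)).card = W.card := by
  have h : W = insert v (removeNbhd G W v ∪ W.filter (G.Adj v)) := by
    ext w
    simp only [Finset.mem_insert, Finset.mem_union, mem_removeNbhd, Finset.mem_filter]
    constructor
    · intro hw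
      tauto
    · rintro (rfl | h | h)
      exacts [hv, h.1, h.1]
  conv_rhs => rw [h]
  rw [Finset.card_insert_of_notMem, Finset.card_union_of_disjoint]
  · ring
  · rw [Finset.disjoint_left]
    intro w h1 h2
    exact (mem_removeNbhd.1 h1).2.2 (Finset.mem_filter.1 h2).2
  · simp [mem_removeNbhd]

lemma card_removeNbhd_add_le {W : Finset α} {v : α} (hv : v ∈ W) {k : ℕ}
    (hk : k ≤ (W.filter (G.Adj v)).card) : (removeNbhd G W v).card + (k + 1) ≤ W.card := by
  have := card_removeNbhd (G := G) hv
  omega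

lemma mem_maxIndep_erase {W I : Finset α} {v : α} (hI : I ∈ maxIndep G W) (hv : v ∉ I) :
    I ∈ maxIndep G (W.erase v) := by
  rw [mem_maxIndep] at hI ⊢
  exact ⟨fun x hx => Finset.mem_erase.2 ⟨fun h => hv (h ▸ hx), hI.1 hx⟩, hI.2.1,
    fun u hu => hI.2.2 u (Finset.mem_of_mem_erase hu)⟩

lemma card_filter_mem_maxIndep_le (W : Finset α) (v : α) :
    ((maxIndep G W).filter (v ∈ ·)).card ≤ (maxIndep G (removeNbhd G W v)).card := by
  refine Finset.card_le_card_of_injOn (fun I => I.erase v) ?_ ?_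
  · intro I hI
    simp only [Finset.coe_filter, Set.mem_ofPred_eq, mem_maxIndep] at hI
    obtain ⟨⟨hIW, hind, hmax⟩, hvI⟩ := hI
    simp only [Finset.mem_coe, mem_maxIndep]
    refine ⟨fun x hx => ?_, fun x hx y hy => ?_, fun u hu hu' => ?_⟩
    · rw [Finset.mem_erase] at hx
      exact mem_removeNbhd.2 ⟨hIW hx.2, hx.1, hind v hvI x hx.2⟩
    · exact hind x (Finset.mem_of_mem_erase hx) y (Finset.mem_of_mem_erase hy)
    · rw [mem_removeNbhd] at hu
      obtain ⟨w, hw, hadj⟩ := hmax u hu.1 fun h => hu' (Finset.mem_erase.2 ⟨hu.2.1, h⟩)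
      refine ⟨w, Finset.mem_erase.2 ⟨?_, hw⟩, hadj⟩
      rintro rfl
      exact hu.2.2 hadj.symm
  · intro I hI J hJ h
    simp only [Finset.coe_filter, Set.mem_ofPred_eq] at hI hJ
    have h' : I.erase v = J.erase v := h
    rw [← Finset.insert_erase hI.2, ← Finset.insert_erase hJ.2, h']

lemma card_maxIndep_le_branch (W : Finset α) (v : α) :
    (maxIndep G W).card ≤
      (maxIndep G (W.erase v)).card + (maxIndep G (removeNbhd G W v)).card := by
  rw [← Finset.card_filter_add_card_filter_not (s := maxIndep G W) (v ∈ ·), add_comm]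
  refine add_le_add (Finset.card_le_card fun I hI => ?_) (card_filter_mem_maxIndep_le W v)
  rw [Finset.mem_filter] at hI
  exact mem_maxIndep_erase hI.1 hI.2

lemma card_maxIndep_le_of_isolated {W : Finset α} {v : α} (hv : v ∈ W)
    (h : W.filter (G.Adj v) = ∅) :
    (maxIndep G W).card ≤ (maxIndep G (removeNbhd G W v)).card := by
  refine le_trans (Finset.card_le_card fun I hI => ?_) (card_filter_mem_maxIndep_le W v)
  refine Finset.mem_filter.2 ⟨hI, ?_⟩
  rw [mem_maxIndep] at hI
  by_contra hvI
  obtain ⟨u, hu, hadj⟩ := hI.2.2 v hv hvI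
  exact Finset.filter_eq_empty_iff.1 h (hI.1 hu) hadj

lemma card_maxIndep_le_of_leaf {W : Finset α} {v y : α} (hv : v ∈ W)
    (h : W.filter (G.Adj v) = {y}) :
    (maxIndep G W).card ≤
      (maxIndep G (removeNbhd G W v)).card + (maxIndep G (removeNbhd G W y)).card := by
  refine le_trans (Finset.card_le_card fun I hI => ?_) ((Finset.card_union_le _ _).trans
    (add_le_add (card_filter_mem_maxIndep_le W v) (card_filter_mem_maxIndep_le W y)))
  rw [Finset.mem_union, Finset.mem_filter, Finset.mem_filter]
  by_cases hvI : v ∈ I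
  · exact Or.inl ⟨hI, hvI⟩
  · refine Or.inr ⟨hI, ?_⟩
    rw [mem_maxIndep] at hI
    obtain ⟨u, hu, hadj⟩ := hI.2.2 v hv hvI
    have : u ∈ W.filter (G.Adj v) := Finset.mem_filter.2 ⟨hI.1 hu, hadj⟩
    rw [h, Finset.mem_singleton] at this
    exact this ▸ hu

lemma card_maxIndep_le_of_degree_two {W : Finset α} {v y z : α} (hv : v ∈ W)
    (h : W.filter (G.Adj v) = {y, z}) :
    (maxIndep G W).card ≤
      (maxIndep G (removeNbhd G W v)).card + (maxIndep G (removeNbhd G W y)).card +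
        (maxIndep G (removeNbhd G (W.erase y) z)).card := by
  refine le_trans (Finset.card_le_card fun I hI => ?_) ((Finset.card_union_le _ _).trans
    (add_le_add ((Finset.card_union_le _ _).trans
    (add_le_add (card_filter_mem_maxIndep_le W v) (card_filter_mem_maxIndep_le W y)))
      (card_filter_mem_maxIndep_le (W.erase y) z)))
  simp only [Finset.mem_union, Finset.mem_filter]
  by_cases hvI : v ∈ I
  · exact Or.inl (Or.inl ⟨hI, hvI⟩)
  by_cases hyI : y ∈ I
  · exact Or.inl (Or.inr ⟨hI, hyI⟩)
  refine Or.inr ⟨mem_maxIndep_erase hI hyI, ?_⟩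
  rw [mem_maxIndep] at hI
  obtain ⟨u, hu, hadj⟩ := hI.2.2 v hv hvI
  have : u ∈ W.filter (G.Adj v) := Finset.mem_filter.2 ⟨hI.1 hu, hadj⟩
  rw [h, Finset.mem_insert, Finset.mem_singleton] at this
  rcases this with rfl | rfl
  · exact absurd hu hyI
  · exact hu

lemma card_maxIndep_empty : (maxIndep G (∅ : Finset α)).card ≤ 1 :=
  (Finset.card_filter_le _ _).trans (by simp)

lemma pow_mul_pow_le_pow {c : ℝ} (hc : 1 ≤ c) {a b k : ℕ} (h : a + k ≤ b) :
    c ^ k * c ^ a ≤ c ^ b := by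
  rw [← pow_add]
  exact pow_le_pow_right₀ hc (by omega)

lemma card_maxIndep_le_three_halves_pow (W : Finset α) :
    ((maxIndep G W).card : ℝ) ≤ (3 / 2 : ℝ) ^ W.card := by
  induction hm : W.card using Nat.strong_induction_on generalizing W with
  | _ m ih =>
  subst hm
  have hc : (1 : ℝ) ≤ 3 / 2 := by norm_num
  rcases W.eq_empty_or_nonempty with rfl | ⟨v, hv⟩
  · simpa using card_maxIndep_empty (G := G)
  have key : ∀ x ∈ W, ∀ k : ℕ, k ≤ (W.filter (G.Adj x)).card →
      (3 / 2 : ℝ) ^ (k + 1) * (maxIndep G (removeNbhd G W x)).card ≤ (3 / 2 : ℝ) ^ W.card := by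
    intro x hx k hk
    have h1 := card_removeNbhd_add_le hx hk
    exact (mul_le_mul_of_nonneg_left (ih _ (by omega) _ rfl) (by positivity)).trans
      (pow_mul_pow_le_pow hc h1)
  by_cases hdeg : ∃ x ∈ W, 2 ≤ (W.filter (G.Adj x)).card
  · obtain ⟨x, hx, hx2⟩ := hdeg
    have h1 := key x hx 2 hx2
    have hcard := Finset.card_erase_add_one hx
    have h2 := (mul_le_mul_of_nonneg_left (ih _ (by omega) (W.erase x) rfl)
      (by positivity : (0 : ℝ) ≤ (3 / 2) ^ 1)).trans (pow_mul_pow_le_pow hc hcard.le)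
    have h3 : ((maxIndep G W).card : ℝ) ≤ _ := Nat.cast_le.2 (card_maxIndep_le_branch W x)
    push_cast at h3
    norm_num at h1 h2 ⊢
    have : (0 : ℝ) < (3 / 2) ^ W.card := by positivity
    linarith
  push Not at hdeg
  have hv2 := hdeg v hv
  interval_cases hd : (W.filter (G.Adj v)).card
  · have h1 := key v hv 0 (Nat.zero_le _)
    have h3 : ((maxIndep G W).card : ℝ) ≤ _ :=
      Nat.cast_le.2 (card_maxIndep_le_of_isolated hv (Finset.card_eq_zero.1 hd))
    norm_num at h1
    have : (0 : ℝ) ≤ (maxIndep G (removeNbhd G W v)).card := by positivity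
    linarith
  · obtain ⟨y, hy⟩ := Finset.card_eq_one.1 hd
    have hyv : y ∈ W.filter (G.Adj v) := hy ▸ Finset.mem_singleton_self y
    rw [Finset.mem_filter] at hyv
    have h1 := key v hv 1 hd.ge
    have h2 := key y hyv.1 1 (Finset.card_pos.2 ⟨v, Finset.mem_filter.2 ⟨hv, hyv.2.symm⟩⟩)
    have h3 : ((maxIndep G W).card : ℝ) ≤ _ := Nat.cast_le.2 (card_maxIndep_le_of_leaf hv hy)
    push_cast at h3
    norm_num at h1 h2
    have : (0 : ℝ) < (3 / 2) ^ W.card := by positivity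
    linarith

/-- If all triangles of `G` inside `W` lie inside `T`, then the Hujter–Tuza bound holds up to
a factor `2 ^ |T|`. -/
lemma card_maxIndep_le_of_triangles_subset (T W : Finset α)
    (hT : ∀ x ∈ W, ∀ y ∈ W, ∀ z ∈ W, G.Adj x y → G.Adj x z → G.Adj y z → x ∈ T) :
    ((maxIndep G W).card : ℝ) ≤ 2 ^ (W ∩ T).card * √2 ^ W.card := by
  induction hm : W.card using Nat.strong_induction_on generalizing W with
  | _ m ih =>
  subst hm
  have hc : (1 : ℝ) ≤ √2 := by
    rw [Real.one_le_sqrt]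
    norm_num
  have hsq : √2 ^ 2 = (2 : ℝ) := Real.sq_sqrt (by norm_num)
  rcases W.eq_empty_or_nonempty with rfl | ⟨v, hv⟩
  · simpa using card_maxIndep_empty (G := G)
  have sub : ∀ U ⊆ W, ∀ k : ℕ, U.card + (k + 1) ≤ W.card →
      √2 ^ (k + 1) * (maxIndep G U).card ≤ 2 ^ (U ∩ T).card * √2 ^ W.card := by
    intro U hU k hk
    have h1 := ih _ (by omega) U (fun x hx y hy z hz => hT x (hU hx) y (hU hy) z (hU hz)) rfl
    have h2 := pow_mul_pow_le_pow hc hk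
    calc √2 ^ (k + 1) * (maxIndep G U).card
        ≤ √2 ^ (k + 1) * (2 ^ (U ∩ T).card * √2 ^ U.card) := by gcongr
      _ = 2 ^ (U ∩ T).card * (√2 ^ (k + 1) * √2 ^ U.card) := by ring
      _ ≤ _ := by gcongr
  by_cases hWT : (W ∩ T).Nonempty
  · obtain ⟨x, hx⟩ := hWT
    have hxW := Finset.mem_of_mem_inter_left hx
    have hcard := Finset.card_erase_add_one hxW
    have aux : ∀ U ⊆ W.erase x, 2 * ((maxIndep G U).card : ℝ) ≤
        2 ^ (W ∩ T).card * √2 ^ W.card := by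
      intro U hU
      have h1 := sub U (hU.trans (Finset.erase_subset _ _)) 0
        (by have := Finset.card_le_card hU; omega)
      have h2 : (U ∩ T).card + 1 ≤ (W ∩ T).card := by
        rw [← Finset.card_erase_add_one hx]
        refine Nat.succ_le_succ (Finset.card_le_card fun u hu => ?_)
        rw [Finset.mem_inter] at hu
        have := Finset.mem_erase.1 (hU hu.1)
        exact Finset.mem_erase.2 ⟨this.1, Finset.mem_inter.2 ⟨this.2, hu.2⟩⟩
      have h3 : ((maxIndep G U).card : ℝ) ≤ 2 ^ (U ∩ T).card * √2 ^ W.card :=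
        le_trans (le_mul_of_one_le_left (by positivity) (one_le_pow₀ hc)) h1
      calc 2 * ((maxIndep G U).card : ℝ) ≤ 2 ^ 1 * (2 ^ (U ∩ T).card * √2 ^ W.card) := by
            linarith
        _ = (2 ^ 1 * 2 ^ (U ∩ T).card) * √2 ^ W.card := by ring
        _ ≤ _ := by
          gcongr
          exact pow_mul_pow_le_pow (by norm_num) h2
    have h1 := aux _ subset_rfl
    have h2 := aux (removeNbhd G W x) fun u hu => by
      rw [mem_removeNbhd] at hu
      exact Finset.mem_erase.2 ⟨hu.2.1, hu.1⟩
    have h3 : ((maxIndep G W).card : ℝ) ≤ _ := Nat.cast_le.2 (card_maxIndep_le_branch W x)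
    push_cast at h3
    linarith
  rw [Finset.not_nonempty_iff_eq_empty] at hWT
  have hWT' : ∀ x ∈ W, x ∉ T := fun x hx hxT =>
    Finset.notMem_empty x (hWT ▸ Finset.mem_inter.2 ⟨hx, hxT⟩)
  have sub' : ∀ U ⊆ W, ∀ k : ℕ, U.card + (k + 1) ≤ W.card →
      √2 ^ (k + 1) * (maxIndep G U).card ≤ √2 ^ W.card := by
    intro U hU k hk
    have : U ∩ T = ∅ := Finset.subset_empty.1 (hWT ▸ Finset.inter_subset_inter_right hU)
    simpa [this] using sub U hU k hk
  have key : ∀ x ∈ W, ∀ k : ℕ, k ≤ (W.filter (G.Adj x)).card →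
      √2 ^ (k + 1) * (maxIndep G (removeNbhd G W x)).card ≤ √2 ^ W.card := fun x hx k hk =>
    sub' _ (removeNbhd_subset W x) k (card_removeNbhd_add_le hx hk)
  rw [hWT, Finset.card_empty, pow_zero, one_mul]
  have hpos : (0 : ℝ) < √2 ^ W.card := by positivity
  have h3' : √2 ^ 3 = 2 * √2 := by rw [pow_succ, hsq]
  have h4' : √2 ^ 4 = (4 : ℝ) := by
    rw [show (4 : ℕ) = 2 * 2 from rfl, pow_mul, hsq]
    norm_num
  have hlow : (1.41 : ℝ) ≤ √2 := Real.le_sqrt_of_sq_le (by norm_num)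
  have pow_one_bound : ∀ t : ℝ, 0 ≤ t → √2 ^ 1 * t ≤ √2 ^ W.card → 1.41 * t ≤ √2 ^ W.card := by
    intro t ht h
    rw [pow_one] at h
    nlinarith
  have pow_three_bound : ∀ t : ℝ, 0 ≤ t → √2 ^ 3 * t ≤ √2 ^ W.card →
      2.82 * t ≤ √2 ^ W.card := by
    intro t ht h
    rw [h3'] at h
    nlinarith
  by_cases hdeg : ∃ x ∈ W, 3 ≤ (W.filter (G.Adj x)).card
  · obtain ⟨x, hx, hx2⟩ := hdeg
    have h1 := key x hx 3 hx2
    have hcard := Finset.card_erase_add_one hx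
    have h2 := pow_one_bound _ (by positivity) (sub' (W.erase x) (Finset.erase_subset _ _) 0
      hcard.le)
    have h3 : ((maxIndep G W).card : ℝ) ≤ _ := Nat.cast_le.2 (card_maxIndep_le_branch W x)
    push_cast at h3
    rw [h4'] at h1
    linarith
  by_cases hdeg1 : ∃ x ∈ W, (W.filter (G.Adj x)).card = 1
  · obtain ⟨x, hx, hd⟩ := hdeg1
    obtain ⟨y, hy⟩ := Finset.card_eq_one.1 hd
    have hyx : y ∈ W.filter (G.Adj x) := hy ▸ Finset.mem_singleton_self y
    rw [Finset.mem_filter] at hyx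
    have h1 := key x hx 1 hd.ge
    have h2 := key y hyx.1 1 (Finset.card_pos.2 ⟨x, Finset.mem_filter.2 ⟨hx, hyx.2.symm⟩⟩)
    have h3 : ((maxIndep G W).card : ℝ) ≤ _ := Nat.cast_le.2 (card_maxIndep_le_of_leaf hx hy)
    push_cast at h3
    rw [hsq] at h1 h2
    linarith
  push Not at hdeg hdeg1
  have hv3 := hdeg v hv
  have hv1 := hdeg1 v hv
  by_cases hd0 : (W.filter (G.Adj v)).card = 0
  · have h1 := pow_one_bound _ (by positivity) (key v hv 0 (Nat.zero_le _))
    have h3 : ((maxIndep G W).card : ℝ) ≤ _ :=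
      Nat.cast_le.2 (card_maxIndep_le_of_isolated hv (Finset.card_eq_zero.1 hd0))
    have : (0 : ℝ) ≤ (maxIndep G (removeNbhd G W v)).card := by positivity
    linarith
  have hd : (W.filter (G.Adj v)).card = 2 := by omega
  obtain ⟨y, z, hyz, h⟩ := Finset.card_eq_two.1 hd
  have hy : y ∈ W.filter (G.Adj v) := by simp [h]
  have hz : z ∈ W.filter (G.Adj v) := by simp [h]
  rw [Finset.mem_filter] at hy hz
  have two_le : ∀ x ∈ W, G.Adj v x → 2 ≤ (W.filter (G.Adj x)).card := by
    intro x hx hadj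
    have : 0 < (W.filter (G.Adj x)).card :=
      Finset.card_pos.2 ⟨v, Finset.mem_filter.2 ⟨hv, hadj.symm⟩⟩
    have := hdeg1 x hx
    omega
  have hnyz : ¬ G.Adj z y := fun hadj =>
    hWT' v hv (hT v hv z hz.1 y hy.1 hz.2 hy.2 hadj)
  have h1 := pow_three_bound _ (by positivity) (key v hv 2 hd.ge)
  have h2 := pow_three_bound _ (by positivity) (key y hy.1 2 (two_le y hy.1 hy.2))
  have herase : (W.erase y).filter (G.Adj z) = W.filter (G.Adj z) := by
    ext u
    simp only [Finset.mem_filter, Finset.mem_erase]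
    constructor
    · tauto
    · rintro ⟨hu, hadj⟩
      refine ⟨⟨?_, hu⟩, hadj⟩
      rintro rfl
      exact hnyz hadj
  have hcard := Finset.card_erase_add_one hy.1
  have hcard' := card_removeNbhd_add_le (G := G) (k := 2)
    (Finset.mem_erase.2 ⟨hyz.symm, hz.1⟩) (herase ▸ two_le z hz.1 hz.2)
  have h3 := sub' (removeNbhd G (W.erase y) z)
    ((removeNbhd_subset _ _).trans (Finset.erase_subset _ _)) 3 (by omega)
  have h5 : ((maxIndep G W).card : ℝ) ≤ _ :=
    Nat.cast_le.2 (card_maxIndep_le_of_degree_two hv h)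
  push_cast at h5
  rw [h4'] at h3
  linarith

/-- If every set of more than `q` vertices induces a subgraph with a vertex of large degree, then
the number of maximal independent sets is controlled by `q`. -/
lemma card_maxIndep_le_of_large_degree (V : Finset α) (q : ℕ)
    (hq : ∀ W ⊆ V, q < W.card → ∃ v ∈ W, 700 ≤ (W.filter (G.Adj v)).card)
    (W : Finset α) (hW : W ⊆ V) :
    ((maxIndep G W).card : ℝ) ≤ (3 / 2) ^ q * (1.008 : ℝ) ^ W.card := by
  induction hm : W.card using Nat.strong_induction_on generalizing W with
  | _ m ih =>
  subst hm
  have hc : (1 : ℝ) ≤ 1.008 := by norm_num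
  by_cases hWq : W.card ≤ q
  · calc ((maxIndep G W).card : ℝ) ≤ (3 / 2) ^ W.card * 1 := by
          rw [mul_one]
          exact card_maxIndep_le_three_halves_pow W
      _ ≤ _ := by
        gcongr
        · norm_num
        · exact one_le_pow₀ hc
  obtain ⟨v, hv, hdeg⟩ := hq W hW (by omega)
  have key : ∀ U ⊆ W, ∀ k : ℕ, U.card + (k + 1) ≤ W.card →
      1.008 ^ (k + 1) * ((maxIndep G U).card : ℝ) ≤ (3 / 2) ^ q * 1.008 ^ W.card := by
    intro U hU k hk
    have h1 := ih _ (by omega) U (hU.trans hW) rfl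
    have h2 := pow_mul_pow_le_pow hc hk
    calc 1.008 ^ (k + 1) * ((maxIndep G U).card : ℝ)
        ≤ 1.008 ^ (k + 1) * ((3 / 2) ^ q * 1.008 ^ U.card) := by gcongr
      _ = (3 / 2) ^ q * (1.008 ^ (k + 1) * 1.008 ^ U.card) := by ring
      _ ≤ _ := by gcongr
  have h1 := key _ (removeNbhd_subset W v) 700 (card_removeNbhd_add_le hv hdeg)
  have h2 := key _ (Finset.erase_subset v W) 0 (Finset.card_erase_add_one hv).le
  have h3 : ((maxIndep G W).card : ℝ) ≤ _ := Nat.cast_le.2 (card_maxIndep_le_branch W v)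
  push_cast at h3
  have hpow : (127 : ℝ) ≤ 1.008 ^ (700 + 1) := by
    calc (127 : ℝ) ≤ (1.008 ^ 100) ^ 7 := by norm_num
      _ = 1.008 ^ 700 := by rw [← pow_mul]
      _ ≤ 1.008 ^ (700 + 1) := pow_le_pow_right₀ hc (by norm_num)
  have h4 : 127 * ((maxIndep G (removeNbhd G W v)).card : ℝ) ≤ (3 / 2) ^ q * 1.008 ^ W.card :=
    (mul_le_mul_of_nonneg_right hpow (by positivity)).trans h1
  rw [zero_add, pow_one] at h2
  linarith

/-- A graph whose degrees on `V` all lie between roughly `s / 2` and `2 * s` has a vertex of large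
degree in every large induced subgraph. -/
lemma exists_large_degree (V : Finset α) (s : ℕ) (hs : 15000 ≤ s)
    (hlow : ∀ v ∈ V, s ≤ 2 * (V.filter (G.Adj v)).card + 1)
    (hup : ∀ v ∈ V, (V.filter (G.Adj v)).card ≤ 2 * s)
    (W : Finset α) (hW : W ⊆ V) (hcard : 5 * V.card < 6 * W.card) :
    ∃ v ∈ W, 700 ≤ (W.filter (G.Adj v)).card := by
  by_contra! hcon
  have hdc := Finset.sum_card_bipartiteAbove_eq_sum_card_bipartiteBelow
    (s := W) (t := V \ W) (r := G.Adj)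
  have h1 : W.card * s ≤ ∑ v ∈ W, (2 * (Finset.bipartiteAbove G.Adj (V \ W) v).card + 1400) := by
    rw [← smul_eq_mul]
    refine Finset.card_nsmul_le_sum _ _ _ fun v hv => ?_
    have h2 := hlow v (hW hv)
    have h3 := hcon v hv
    have h4 : (V.filter (G.Adj v)).card ≤
        (Finset.bipartiteAbove G.Adj (V \ W) v).card + (W.filter (G.Adj v)).card := by
      refine (Finset.card_le_card fun u hu => ?_).trans (Finset.card_union_le _ _)
      simp only [Finset.mem_union, Finset.mem_filter, Finset.bipartiteAbove,
        Finset.mem_sdiff] at hu ⊢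
      tauto
    omega
  have h2 : ∑ v ∈ V \ W, (Finset.bipartiteBelow G.Adj W v).card ≤ (V \ W).card * (2 * s) := by
    rw [← smul_eq_mul]
    refine Finset.sum_le_card_nsmul _ _ _ fun v hv => ?_
    refine (Finset.card_le_card fun u hu => ?_).trans (hup v (Finset.mem_sdiff.1 hv).1)
    simp only [Finset.mem_filter, Finset.bipartiteBelow] at hu ⊢
    exact ⟨hW hu.1, hu.2.symm⟩
  rw [Finset.sum_add_distrib, ← Finset.mul_sum, Finset.sum_const, smul_eq_mul, hdc] at h1
  have h3 := Finset.card_sdiff_add_card_eq_card hW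
  have h4 : 5 * (V \ W).card < W.card := by omega
  nlinarith

end MaxIndep

/-- The link graph of `S`: distinct `x` and `y` are joined if they form a Schur triple with some
element of `S`. -/
def linkGraph (S : Finset ℕ) : SimpleGraph ℕ where
  Adj x y := x ≠ y ∧ ∃ s ∈ S, x + s = y ∨ y + s = x ∨ x + y = s
  symm := ⟨by
    rintro x y ⟨hne, s, hs, h⟩
    exact ⟨hne.symm, s, hs, by omega⟩⟩
  loopless := ⟨fun x h => h.1 rfl⟩

instance (S : Finset ℕ) : DecidableRel (linkGraph S).Adj := fun x y =>
  inferInstanceAs (Decidable (x ≠ y ∧ ∃ s ∈ S, x + s = y ∨ y + s = x ∨ x + y = s))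

/-- The odd elements of `[n]`. -/
def oddsUpTo (n : ℕ) : Finset ℕ := (Finset.Icc 1 n).filter Odd

lemma mem_oddsUpTo {n x : ℕ} : x ∈ oddsUpTo n ↔ (1 ≤ x ∧ x ≤ n) ∧ Odd x := by
  simp [oddsUpTo]

lemma two_mul_card_oddsUpTo_le (n : ℕ) : 2 * (oddsUpTo n).card ≤ n + 1 := by
  have h : oddsUpTo n ⊆ (Finset.range ((n + 1) / 2)).image (2 * · + 1) := by
    intro x hx
    obtain ⟨hx, k, rfl⟩ := mem_oddsUpTo.1 hx
    exact Finset.mem_image.2 ⟨k, Finset.mem_range.2 (by omega), rfl⟩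
  have := (Finset.card_le_card h).trans Finset.card_image_le
  rw [Finset.card_range] at this
  omega

lemma card_link_degree_le (S V : Finset ℕ) (x : ℕ) :
    (V.filter ((linkGraph S).Adj x)).card ≤ 2 * S.card := by
  have h : V.filter ((linkGraph S).Adj x) ⊆
      S.image (x + ·) ∪ S.image (fun s => (x - s) + (s - x)) := by
    intro y hy
    obtain ⟨-, -, s, hs, h⟩ := Finset.mem_filter.1 hy
    rw [Finset.mem_union, Finset.mem_image, Finset.mem_image]
    rcases h with h | h | h
    · exact Or.inl ⟨s, hs, h⟩
    · exact Or.inr ⟨s, hs, by omega⟩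
    · exact Or.inr ⟨s, hs, by omega⟩
  have := (Finset.card_le_card h).trans (Finset.card_union_le _ _)
  have h1 := Finset.card_image_le (s := S) (f := (x + ·))
  have h2 := Finset.card_image_le (s := S) (f := fun s => (x - s) + (s - x))
  omega

lemma card_le_link_degree {n : ℕ} {S : Finset ℕ} (hS : S ⊆ Finset.Icc 1 n)
    (heven : ∀ s ∈ S, Even s) {x : ℕ} (hx : x ∈ oddsUpTo n) :
    S.card ≤ 2 * ((oddsUpTo n).filter ((linkGraph S).Adj x)).card + 1 := by
  set N := (oddsUpTo n).filter ((linkGraph S).Adj x)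
  have h : S ⊆ insert (2 * x) (N.image (x + ·) ∪ N.image (x - ·)) := by
    intro s hs
    rw [Finset.mem_insert]
    by_cases hsx : s = 2 * x
    · exact Or.inl hsx
    have hsn := Finset.mem_Icc.1 (hS hs)
    obtain ⟨hxn, j, hj⟩ := mem_oddsUpTo.1 hx
    obtain ⟨k, hk⟩ := heven s hs
    have hN : (x - s) + (s - x) ∈ N := by
      refine Finset.mem_filter.2 ⟨mem_oddsUpTo.2 ⟨by omega, ?_⟩, by omega, s, hs, by omega⟩
      rw [Nat.odd_iff]
      omega
    rw [Finset.mem_union, Finset.mem_image, Finset.mem_image]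
    rcases le_total s x with h | h
    · exact Or.inr (Or.inr ⟨_, hN, by omega⟩)
    · exact Or.inr (Or.inl ⟨_, hN, by omega⟩)
  have h0 := (Finset.card_le_card h).trans (Finset.card_insert_le _ _)
  have h1 := Finset.card_union_le (N.image (x + ·)) (N.image (x - ·))
  have h2 := Finset.card_image_le (s := N) (f := (x + ·))
  have h3 := Finset.card_image_le (s := N) (f := (x - ·))
  omega

open scoped Pointwise in
/-- The link graph of a sum-free set `S` has a number of vertices in triangles bounded in terms of
`S` only. -/
lemma exists_link_triangles_subset {S : Finset ℕ} (hS : SumFree S) :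
    ∃ T : Finset ℕ, T.card ≤ (2 * S.card) ^ 3 ∧
      ∀ x y z : ℕ, 0 < x → 0 < y → 0 < z → (linkGraph S).Adj x y → (linkGraph S).Adj x z →
        (linkGraph S).Adj y z → x ∈ T := by
  set D : Finset ℤ := S.image (fun s : ℕ => (s : ℤ)) ∪ S.image (fun s : ℕ => -(s : ℤ))
  have hD : D.card ≤ 2 * S.card := by
    have : D.card ≤ _ := Finset.card_union_le _ _
    have h1 := Finset.card_image_le (s := S) (f := fun s : ℕ => (s : ℤ))
    have h2 := Finset.card_image_le (s := S) (f := fun s : ℕ => -(s : ℤ))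
    omega
  have hpos : ∀ s ∈ S, (s : ℤ) ∈ D := fun s hs =>
    Finset.mem_union_left _ (Finset.mem_image_of_mem _ hs)
  have hneg : ∀ s ∈ S, -(s : ℤ) ∈ D := fun s hs =>
    Finset.mem_union_right _ (Finset.mem_image_of_mem (fun s : ℕ => -(s : ℤ)) hs)
  refine ⟨(D + D + D).image fun a => (a / 2).toNat, ?_, ?_⟩
  · calc _ ≤ (D + D + D).card := Finset.card_image_le
      _ ≤ D.card * D.card * D.card :=
        Finset.card_add_le.trans (Nat.mul_le_mul_right _ Finset.card_add_le)
      _ = D.card ^ 3 := by ring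
      _ ≤ _ := Nat.pow_le_pow_left hD 3
  · rintro x y z hx hy hz ⟨-, a, ha, hxy⟩ ⟨-, b, hb, hxz⟩ ⟨-, c, hc, hyz⟩
    have h1 : a + b ≠ c := fun h => hS a ha b hb (h ▸ hc)
    have h2 : a + c ≠ b := fun h => hS a ha c hc (h ▸ hb)
    have h3 : b + c ≠ a := fun h => hS b hb c hc (h ▸ ha)
    have key : ∃ p ∈ D, ∃ q ∈ D, ∃ r ∈ D, p + q + r = 2 * (x : ℤ) := by
      have hsign : ∃ i j k : ℤ, (i = a ∨ i = -a) ∧ (j = b ∨ j = -b) ∧ (k = c ∨ k = -c) ∧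
          i + j + k = 2 * (x : ℤ) := by
        rcases hxy with h | h | h <;> rcases hxz with h' | h' | h' <;>
          rcases hyz with h'' | h'' | h'' <;>
          first
          | (exfalso; omega)
          | exact ⟨a, b, -c, Or.inl rfl, Or.inl rfl, Or.inr rfl, by omega⟩
          | exact ⟨a, -b, c, Or.inl rfl, Or.inr rfl, Or.inl rfl, by omega⟩
          | exact ⟨a, -b, -c, Or.inl rfl, Or.inr rfl, Or.inr rfl, by omega⟩
          | exact ⟨-a, b, c, Or.inr rfl, Or.inl rfl, Or.inl rfl, by omega⟩
          | exact ⟨-a, b, -c, Or.inr rfl, Or.inl rfl, Or.inr rfl, by omega⟩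
          | exact ⟨-a, -b, c, Or.inr rfl, Or.inr rfl, Or.inl rfl, by omega⟩
          | exact ⟨a, b, c, Or.inl rfl, Or.inl rfl, Or.inl rfl, by omega⟩
      obtain ⟨i, j, k, hi, hj, hk, h⟩ := hsign
      refine ⟨i, ?_, j, ?_, k, ?_, h⟩
      · rcases hi with rfl | rfl
        exacts [hpos a ha, hneg a ha]
      · rcases hj with rfl | rfl
        exacts [hpos b hb, hneg b hb]
      · rcases hk with rfl | rfl
        exacts [hpos c hc, hneg c hc]
    obtain ⟨p, hp, q, hq, r, hr, h⟩ := key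
    refine Finset.mem_image.2 ⟨p + q + r, Finset.add_mem_add (Finset.add_mem_add hp hq) hr, ?_⟩
    omega

/-- The vertices of the link graph of `S` that can lie in a sum-free set containing `S`. -/
def linkVertices (n : ℕ) (S : Finset ℕ) : Finset ℕ :=
  (oddsUpTo n).filter fun x => x + x ∉ S

lemma linkVertices_subset (n : ℕ) (S : Finset ℕ) : linkVertices n S ⊆ oddsUpTo n :=
  Finset.filter_subset _ _

lemma card_maxIndep_link_le_of_card_ge {n : ℕ} {S : Finset ℕ} (hS : S ⊆ Finset.Icc 1 n)
    (heven : ∀ s ∈ S, Even s) (hcard : 15000 ≤ S.card) :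
    ((maxIndep (linkGraph S) (linkVertices n S)).card : ℝ) ≤ √2 ^ (oddsUpTo n).card := by
  set m := (oddsUpTo n).card
  have h1 := card_maxIndep_le_of_large_degree (G := linkGraph S) (oddsUpTo n) (5 * m / 6)
    (fun W hW hWq => exists_large_degree (oddsUpTo n) S.card hcard
      (fun v hv => card_le_link_degree hS heven hv)
      (fun v _ => card_link_degree_le S _ v) W hW (by omega))
    _ (linkVertices_subset n S)
  have h2 : (1.008 : ℝ) ^ (linkVertices n S).card ≤ 1.008 ^ m :=
    pow_le_pow_right₀ (by norm_num) (Finset.card_le_card (linkVertices_subset n S))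
  refine (h1.trans (mul_le_mul_of_nonneg_left h2 (by positivity))).trans ?_
  refine le_of_pow_le_pow_left₀ (n := 6) (by norm_num) (by positivity) ?_
  have h8 : √2 ^ 6 = (8 : ℝ) := by
    change √2 ^ (2 * 3) = 8
    rw [pow_mul, Real.sq_sqrt (by norm_num)]
    norm_num
  calc ((3 / 2 : ℝ) ^ (5 * m / 6) * 1.008 ^ m) ^ 6
      = (3 / 2) ^ (5 * m / 6 * 6) * (1.008 ^ 6) ^ m := by
        rw [mul_pow, ← pow_mul, ← pow_mul, ← pow_mul, mul_comm m 6]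
    _ ≤ (3 / 2) ^ (5 * m) * (1.008 ^ 6) ^ m := by
        refine mul_le_mul_of_nonneg_right ?_ (by positivity)
        exact pow_le_pow_right₀ (by norm_num) (Nat.div_mul_le_self _ _)
    _ = ((3 / 2) ^ 5 * 1.008 ^ 6) ^ m := by rw [pow_mul, mul_pow]
    _ ≤ 8 ^ m := by
        gcongr
        norm_num
    _ = (√2 ^ m) ^ 6 := by rw [← h8, ← pow_mul, ← pow_mul, mul_comm]

lemma exists_card_maxIndep_link_le : ∃ K : ℝ, 1 ≤ K ∧ ∀ (n : ℕ) (S : Finset ℕ),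
    S ⊆ Finset.Icc 1 n → (∀ s ∈ S, Even s) → SumFree S →
      ((maxIndep (linkGraph S) (linkVertices n S)).card : ℝ) ≤ K * √2 ^ (oddsUpTo n).card := by
  obtain ⟨c, hc⟩ : ∃ c : ℕ, c = 15000 := ⟨_, rfl⟩
  have hK : (1 : ℝ) ≤ 2 ^ ((2 * c) ^ 3) := one_le_pow₀ (by norm_num)
  refine ⟨2 ^ ((2 * c) ^ 3), hK, fun n S hS heven hfree => ?_⟩
  rcases le_total c S.card with hcard | hcard
  · exact (card_maxIndep_link_le_of_card_ge hS heven (hc ▸ hcard)).trans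
      (le_mul_of_one_le_left (by positivity) hK)
  obtain ⟨T, hT, htri⟩ := exists_link_triangles_subset hfree
  have hpos : ∀ x ∈ linkVertices n S, 0 < x := fun x hx =>
    (mem_oddsUpTo.1 (linkVertices_subset n S hx)).1.1
  refine (card_maxIndep_le_of_triangles_subset T _ fun x hx y hy z hz =>
    htri x y z (hpos x hx) (hpos y hy) (hpos z hz)).trans ?_
  gcongr
  · norm_num
  · exact (Finset.card_le_card Finset.inter_subset_right).trans
      (hT.trans (Nat.pow_le_pow_left (by omega) 3))
  · rw [Real.one_le_sqrt]
    norm_num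
  · exact linkVertices_subset n S

lemma filter_odd_mem_maxIndep {n : ℕ} {M : Finset ℕ} (hM : IsMaxSumFree n M) :
    M.filter Odd ∈ maxIndep (linkGraph (M.filter Even)) (linkVertices n (M.filter Even)) := by
  obtain ⟨hMn, hfree, hmax⟩ := hM
  rw [mem_maxIndep]
  refine ⟨fun x hx => ?_, fun x hx y hy => ?_, fun v hv hvM => ?_⟩
  · rw [Finset.mem_filter] at hx
    refine Finset.mem_filter.2 ⟨mem_oddsUpTo.2 ⟨Finset.mem_Icc.1 (hMn hx.1), hx.2⟩, fun h => ?_⟩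
    exact hfree x hx.1 x hx.1 (Finset.mem_filter.1 h).1
  · rintro ⟨-, s, hs, h⟩
    rw [Finset.mem_filter] at hx hy hs
    rcases h with h | h | h
    · exact hfree x hx.1 s hs.1 (h ▸ hy.1)
    · exact hfree y hy.1 s hs.1 (h ▸ hx.1)
    · exact hfree x hx.1 y hy.1 (h ▸ hs.1)
  · by_contra! hcon
    obtain ⟨hv, hvv⟩ := Finset.mem_filter.1 hv
    rw [mem_oddsUpTo] at hv
    have hvM' : v ∉ M := fun h => hvM (Finset.mem_filter.2 ⟨h, hv.2⟩)
    have hvv' : v + v ∉ M := fun h => hvv (Finset.mem_filter.2 ⟨h, ⟨v, rfl⟩⟩)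
    have hlink : ∀ u ∈ M, ∀ s ∈ M, Odd u → Even s →
        ¬ (v + s = u ∨ u + s = v ∨ v + u = s) := by
      intro u hu s hs hou hes h
      exact hcon u (Finset.mem_filter.2 ⟨hu, hou⟩)
        ⟨fun h => hvM' (h ▸ hu), s, Finset.mem_filter.2 ⟨hs, hes⟩, h⟩
    have h0 : ∀ s ∈ M, 0 < s := fun s hs => (Finset.mem_Icc.1 (hMn hs)).1
    have hodd := hv.2
    refine hvM' ?_
    rw [hmax (insert v M) (Finset.insert_subset (Finset.mem_Icc.2 hv.1) hMn) ?_
      (Finset.subset_insert _ _)]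
    · exact Finset.mem_insert_self _ _
    · have hvx : ∀ x ∈ M, v + x ∉ M := by
        intro x hx hxM
        rcases Nat.even_or_odd x with hxe | hxo
        · exact hlink _ hxM x hx (hodd.add_even hxe) hxe (Or.inl rfl)
        · exact hlink x hx _ hxM hxo (hodd.add_odd hxo) (Or.inr (Or.inr rfl))
      intro x hx y hy hxy
      rw [Finset.mem_insert] at hx hy hxy
      rcases hx with rfl | hx <;> rcases hy with rfl | hy
      · rcases hxy with h | h
        · have := hv.1.1
          omega
        · exact hvv' h
      · rcases hxy with h | h
        · have := h0 y hy
          omega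
        · exact hvx y hy h
      · rcases hxy with h | h
        · have := h0 x hx
          omega
        · exact hvx x hx (add_comm x y ▸ h)
      · rcases hxy with h | h
        · rcases Nat.even_or_odd x with hxe | hxo
          · have hyo : Odd y := by
              rw [← h, Nat.odd_add] at hodd
              by_contra hyo
              rw [Nat.not_odd_iff_even] at hyo
              exact Nat.not_even_iff_odd.2 (hodd.2 hyo) hxe
            exact hlink y hy x hx hyo hxe (Or.inr (Or.inl (by omega)))
          · have hye : Even y := by
              rw [← h, Nat.odd_add] at hodd
              exact hodd.1 hxo
            exact hlink x hx y hy hxo hye (Or.inr (Or.inl h))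
        · exact hfree x hx y hy h

lemma exists_fmaxIn_le : ∃ K : ℝ, 1 ≤ K ∧ ∀ (n : ℕ) (A : Finset ℕ),
    (fmaxIn n A : ℝ) ≤ 2 ^ (A.filter Even).card * (K * √2 ^ (oddsUpTo n).card) := by
  classical
  obtain ⟨K, hK, hbound⟩ := exists_card_maxIndep_link_le
  refine ⟨K, hK, fun n A => ?_⟩
  set P := ((A.filter Even).powerset).filter fun S => S ⊆ Finset.Icc 1 n ∧ SumFree S
  have hP : ∀ S ∈ P, S ⊆ A.filter Even ∧ S ⊆ Finset.Icc 1 n ∧ SumFree S := fun S hS => by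
    simpa [P] using hS
  have hle : fmaxIn n A ≤
      (P.sigma fun S => maxIndep (linkGraph S) (linkVertices n S)).card := by
    rw [fmaxIn, ← Set.ncard_coe_finset]
    refine Set.ncard_le_ncard_of_injOn
      (fun M => (⟨M.filter Even, M.filter Odd⟩ : Σ _ : Finset ℕ, Finset ℕ)) ?_ ?_
      (Finset.finite_toSet _)
    · rintro M ⟨hM, hMA⟩
      refine Finset.mem_coe.2 (Finset.mem_sigma.2 ⟨?_, filter_odd_mem_maxIndep hM⟩)
      refine Finset.mem_filter.2 ⟨Finset.mem_powerset.2 (Finset.filter_subset_filter _ hMA),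
        (Finset.filter_subset _ _).trans hM.1, fun x hx y hy hxy => ?_⟩
      exact hM.2.1 x (Finset.mem_filter.1 hx).1 y (Finset.mem_filter.1 hy).1
        (Finset.mem_filter.1 hxy).1
    · intro M _ M' _ h
      simp only [Sigma.mk.injEq, heq_eq_eq] at h
      rw [← Finset.filter_union_filter_not_eq Even M, ← Finset.filter_union_filter_not_eq Even M']
      simp only [Nat.not_even_iff_odd]
      rw [h.1, h.2]
  rw [Finset.card_sigma] at hle
  calc (fmaxIn n A : ℝ)
      ≤ ∑ S ∈ P, ((maxIndep (linkGraph S) (linkVertices n S)).card : ℝ) := by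
        exact_mod_cast hle
    _ ≤ P.card • (K * √2 ^ (oddsUpTo n).card) :=
        Finset.sum_le_card_nsmul _ _ _ fun S hS => hbound n S (hP S hS).2.1
          (fun s hs => (Finset.mem_filter.1 ((hP S hS).1 hs)).2) (hP S hS).2.2
    _ ≤ _ := by
        rw [nsmul_eq_mul]
        gcongr
        have : P.card ≤ 2 ^ (A.filter Even).card :=
          (Finset.card_filter_le _ _).trans (Finset.card_powerset _).le
        exact_mod_cast this

theorem stmt13 :
    ∀ ε : ℝ, 0 < ε → ∃ δ : ℝ, 0 < δ ∧ ∃ N : ℕ, ∀ n : ℕ, N ≤ n →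
      ∀ A : Finset ℕ, A ⊆ Finset.Icc 1 n →
        ((A.filter (fun a => Even a)).card : ℝ) ≤ δ * n →
        (fmaxIn n A : ℝ) ≤ (2 : ℝ) ^ ((1 / 4 + ε) * n) := by
  intro ε hε
  obtain ⟨K, hK, hbound⟩ := exists_fmaxIn_le
  obtain ⟨k, hk⟩ := pow_unbounded_of_one_lt K (one_lt_two : (1 : ℝ) < 2)
  refine ⟨ε / 2, by positivity, ⌈2 * (k + 1) / ε⌉₊, fun n hn A _ hA => ?_⟩
  have hn' : (k : ℝ) + 1 ≤ ε / 2 * n := by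
    have := (Nat.le_ceil _).trans (Nat.cast_le.2 hn : (_ : ℝ) ≤ n)
    rw [div_le_iff₀ hε] at this
    linarith
  have hm : 2 * ((oddsUpTo n).card : ℝ) ≤ n + 1 := by exact_mod_cast two_mul_card_oddsUpTo_le n
  calc (fmaxIn n A : ℝ)
      ≤ 2 ^ (A.filter Even).card * (2 ^ k * √2 ^ (oddsUpTo n).card) := by
        refine (hbound n A).trans ?_
        gcongr
    _ = (2 : ℝ) ^ (((A.filter Even).card : ℝ) + (k + 1 / 2 * (oddsUpTo n).card)) := by
        rw [Real.rpow_add two_pos, Real.rpow_add two_pos, Real.rpow_mul two_pos.le,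
          Real.rpow_natCast, Real.rpow_natCast, Real.rpow_natCast, Real.sqrt_eq_rpow]
    _ ≤ _ := by
        refine Real.rpow_le_rpow_of_exponent_le one_le_two ?_
        linarith
end

section
/- Let S be a sum-free set of positive integers and let x < y < z be positive integers such that for each of the three pairs {a, b} ⊆ {x, y, z} with a < b, either b − a ∈ S or a + b ∈ S. Then the number of pairs {a, b} ⊆ {x, y, z} (a < b) with b − a ∈ S is either 0 or 2. -/
theorem stmt14 (S : Set ℕ)
    (hpos : ∀ s ∈ S, 0 < s)
    (hsf : ∀ x ∈ S, ∀ y ∈ S, x + y ∉ S)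
    (x y z : ℕ) (hx : 0 < x) (hxy : x < y) (hyz : y < z)
    (h1 : y - x ∈ S ∨ x + y ∈ S)
    (h2 : z - y ∈ S ∨ y + z ∈ S)
    (h3 : z - x ∈ S ∨ x + z ∈ S) :
    (y - x ∉ S ∧ z - y ∉ S ∧ z - x ∉ S) ∨
    (y - x ∈ S ∧ z - y ∈ S ∧ z - x ∉ S) ∨
    (y - x ∈ S ∧ z - y ∉ S ∧ z - x ∈ S) ∨
    (y - x ∉ S ∧ z - y ∈ S ∧ z - x ∈ S) := by
  have e1 : (y - x) + (z - y) = z - x := by omega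
  have e2 : (y - x) + (x + z) = y + z := by omega
  have e3 : (z - y) + (x + y) = x + z := by omega
  have e4 : (z - x) + (x + y) = y + z := by omega
  have n2 : y - x ∈ S → z - y ∈ S → z - x ∉ S := fun h k => e1 ▸ hsf _ h _ k
  have n3 : y - x ∈ S → x + z ∈ S → y + z ∉ S := fun h k => e2 ▸ hsf _ h _ k
  have n4 : z - y ∈ S → x + y ∈ S → x + z ∉ S := fun h k => e3 ▸ hsf _ h _ k
  have n5 : z - x ∈ S → x + y ∈ S → y + z ∉ S := fun h k => e4 ▸ hsf _ h _ k
  clear e1 e2 e3 e4 hsf hpos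
  by_cases p : y - x ∈ S <;> by_cases q : z - y ∈ S <;> by_cases r : z - x ∈ S <;>
    simp_all
end

section
/- Let n be a positive integer, let S be a nonempty set of even numbers in [n], and let x be an odd number in [n]. Let N(x) be the set of odd numbers y ∈ [n] such that x + y ∈ S or |x − y| ∈ S. Then |S|/2 ≤ |N(x)| ≤ 2|S|. -/
theorem Finset.card_le_two_mul_of_subset_image_union_image {α β : Type*} [DecidableEq β]
    {A : Finset α} {B : Finset β} {f g : α → β} (h : B ⊆ A.image f ∪ A.image g) :
    B.card ≤ 2 * A.card := by
  have h₁ := (Finset.card_le_card h).trans (Finset.card_union_le _ _)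
  have h₂ := A.card_image_le (f := f)
  have h₃ := A.card_image_le (f := g)
  omega

theorem stmt15 (n : ℕ) (hn : 0 < n) (S : Finset ℕ)
    (hS : S ⊆ Finset.Icc 1 n) (hne : S.Nonempty) (heven : ∀ s ∈ S, Even s)
    (x : ℕ) (hx : x ∈ Finset.Icc 1 n) (hodd : Odd x) :
    (S.card : ℝ) / 2 ≤
      (((Finset.Icc 1 n).filter
        (fun y => Odd y ∧ (x + y ∈ S ∨ x - y ∈ S ∨ y - x ∈ S))).card : ℝ) ∧
    (((Finset.Icc 1 n).filter
        (fun y => Odd y ∧ (x + y ∈ S ∨ x - y ∈ S ∨ y - x ∈ S))).card : ℝ) ≤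
      2 * S.card := by
  set N := (Finset.Icc 1 n).filter
    (fun y => Odd y ∧ (x + y ∈ S ∨ x - y ∈ S ∨ y - x ∈ S)) with hN
  have pos_le : ∀ s ∈ S, 1 ≤ s ∧ s ≤ n := fun s hs => Finset.mem_Icc.mp (hS hs)
  rw [Finset.mem_Icc] at hx
  have lower : S.card ≤ 2 * N.card := by
    refine Finset.card_le_two_mul_of_subset_image_union_image
      (f := fun y => x + y) (g := fun y => x - y) fun s hs => ?_
    have hsn := pos_le s hs
    have hse := heven s hs
    simp only [Finset.mem_union, Finset.mem_image, hN, Finset.mem_filter, Finset.mem_Icc]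
    rcases le_or_gt s x with h | h
    · have hsx : x - (x - s) = s := by omega
      exact Or.inr ⟨x - s, ⟨by grind, by grind, by grind⟩, hsx⟩
    · have hsx : x + (s - x) = s := by omega
      exact Or.inl ⟨s - x, ⟨by grind, by grind, by grind⟩, hsx⟩
  have upper : N.card ≤ 2 * S.card := by
    refine Finset.card_le_two_mul_of_subset_image_union_image
      (f := fun s => (s - x) + (x - s)) (g := fun s => s + x) fun y hy => ?_
    simp only [hN, Finset.mem_filter, Finset.mem_Icc] at hy
    simp only [Finset.mem_union, Finset.mem_image]
    obtain ⟨-, -, h | h | h⟩ := hy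
    · exact Or.inl ⟨_, h, by omega⟩
    · have := pos_le _ h
      exact Or.inl ⟨_, h, by omega⟩
    · have := pos_le _ h
      exact Or.inr ⟨_, h, by omega⟩
  have lower' : (S.card : ℝ) ≤ 2 * N.card := by exact_mod_cast lower
  exact ⟨by linarith, by exact_mod_cast upper⟩
end

section
/- Let S be a finite sum-free set of positive integers. Then the number of triples (x, y, z) of positive integers with x < y < z such that for each of the three pairs {a, b} ⊆ {x, y, z} with a < b, either b − a ∈ S or a + b ∈ S, is at most 24·|S|³. -/
theorem stmt16 (S : Finset ℕ) (hpos : ∀ s ∈ S, 0 < s) (hsf : SumFree S) :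
    {p : ℕ × ℕ × ℕ | 0 < p.1 ∧ p.1 < p.2.1 ∧ p.2.1 < p.2.2 ∧
        (p.2.1 - p.1 ∈ S ∨ p.1 + p.2.1 ∈ S) ∧
        (p.2.2 - p.2.1 ∈ S ∨ p.2.1 + p.2.2 ∈ S) ∧
        (p.2.2 - p.1 ∈ S ∨ p.1 + p.2.2 ∈ S)}.Finite ∧
    {p : ℕ × ℕ × ℕ | 0 < p.1 ∧ p.1 < p.2.1 ∧ p.2.1 < p.2.2 ∧
        (p.2.1 - p.1 ∈ S ∨ p.1 + p.2.1 ∈ S) ∧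
        (p.2.2 - p.2.1 ∈ S ∨ p.2.1 + p.2.2 ∈ S) ∧
        (p.2.2 - p.1 ∈ S ∨ p.1 + p.2.2 ∈ S)}.ncard ≤ 24 * S.card ^ 3 := by
  set T := S ×ˢ S ×ˢ S with hT
  let f : ℕ × ℕ × ℕ → ℕ × ℕ × ℕ := fun t =>
    ((t.1 + t.2.2 - t.2.1) / 2, (t.1 + t.2.1 - t.2.2) / 2, (t.2.1 + t.2.2 - t.1) / 2)
  let g : ℕ × ℕ × ℕ → ℕ × ℕ × ℕ := fun t =>
    ((t.2.2 - t.1 - t.2.1) / 2, (t.2.2 + t.1 - t.2.1) / 2, (t.2.2 + t.1 + t.2.1) / 2)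
  let h : ℕ × ℕ × ℕ → ℕ × ℕ × ℕ := fun t =>
    ((t.2.1 - t.1 - t.2.2) / 2, (t.2.1 + t.1 - t.2.2) / 2, (t.2.1 + t.2.2 - t.1) / 2)
  let k : ℕ × ℕ × ℕ → ℕ × ℕ × ℕ := fun t =>
    ((t.1 + t.2.1 - t.2.2) / 2, (t.1 + t.2.2 - t.2.1) / 2, (t.1 + t.2.1 + t.2.2) / 2)
  set U := (T.image f ∪ T.image g) ∪ (T.image h ∪ T.image k) with hU
  have hcard : U.card ≤ 24 * S.card ^ 3 := by
    have hTc : T.card = S.card ^ 3 := by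
      rw [hT, Finset.card_product, Finset.card_product]; ring
    have h1 := Finset.card_union_le (T.image f ∪ T.image g) (T.image h ∪ T.image k)
    have h2 := Finset.card_union_le (T.image f) (T.image g)
    have h3 := Finset.card_union_le (T.image h) (T.image k)
    have hf := Finset.card_image_le (s := T) (f := f)
    have hg := Finset.card_image_le (s := T) (f := g)
    have hh := Finset.card_image_le (s := T) (f := h)
    have hk := Finset.card_image_le (s := T) (f := k)
    rw [hU]
    omega
  have bound_of_subset : ∀ A : Set (ℕ × ℕ × ℕ), A ⊆ U →
      A.Finite ∧ A.ncard ≤ 24 * S.card ^ 3 := fun A hA =>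
    ⟨U.finite_toSet.subset hA,
      (Set.ncard_le_ncard hA U.finite_toSet).trans ((Set.ncard_coe_finset U).trans_le hcard)⟩
  refine bound_of_subset _ ?_
  rintro ⟨x, y, z⟩ ⟨hx, hxy, hyz, ha, hb, hc⟩
  dsimp only at hx hxy hyz ha hb hc
  have key : ∀ a ∈ S, ∀ b ∈ S, ∀ c ∈ S, a + b ≠ c :=
    fun a ha b hb c hc e => hsf a ha b hb (e ▸ hc)
  have mem : ∀ φ : ℕ × ℕ × ℕ → ℕ × ℕ × ℕ, ∀ a ∈ S, ∀ b ∈ S, ∀ c ∈ S,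
      φ (a, b, c) = (x, y, z) → (x, y, z) ∈ T.image φ := fun φ a ha b hb c hc e =>
    Finset.mem_image.2 ⟨(a, b, c), by simp [hT, ha, hb, hc], e⟩
  simp only [hU, Finset.coe_union, Set.mem_union, Finset.mem_coe]
  rcases ha with ha | ha <;> rcases hb with hb | hb <;> rcases hc with hc | hc
  · exact absurd (by omega) (key _ ha _ hb _ hc)
  · exact .inl (.inr (mem g _ ha _ hb _ hc (by simp only [g, Prod.mk.injEq]; omega)))
  · exact .inr (.inl (mem h _ ha _ hb _ hc (by simp only [h, Prod.mk.injEq]; omega)))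
  · exact absurd (by omega) (key _ ha _ hc _ hb)
  · exact .inr (.inr (mem k _ ha _ hb _ hc (by simp only [k, Prod.mk.injEq]; omega)))
  · exact absurd (by omega) (key _ ha _ hb _ hc)
  · exact absurd (by omega) (key _ ha _ hc _ hb)
  · exact .inl (.inl (mem f _ ha _ hb _ hc (by simp only [f, Prod.mk.injEq]; omega)))
end

section
/- Let n be a positive integer, let S ⊆ [n] be a sum-free set, and let x, y, z ∈ [n] with n/2 < x < y < z. Then it is not the case that all three of the pairs {x, y}, {y, z}, {x, z} satisfy the condition that the difference of the pair or the sum of the pair lies in S. (Equivalently, the link graph of S on the interval (n/2, n] is triangle-free.) -/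
theorem stmt17 (n : ℕ) (hn : 0 < n) (S : Finset ℕ)
    (hS : S ⊆ Finset.Icc 1 n) (hsf : SumFree S)
    (x y z : ℕ) (hx : x ∈ Finset.Icc 1 n) (hy : y ∈ Finset.Icc 1 n)
    (hz : z ∈ Finset.Icc 1 n)
    (hhalf : n < 2 * x) (hxy : x < y) (hyz : y < z) :
    ¬ ((y - x ∈ S ∨ x + y ∈ S) ∧ (z - y ∈ S ∨ y + z ∈ S) ∧
       (z - x ∈ S ∨ x + z ∈ S)) := by
  have notMem_of_lt : ∀ m, n < m → m ∉ S := fun m hm hmS =>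
    hm.not_ge (Finset.mem_Icc.mp (hS hmS)).2
  rintro ⟨hxy', hyz', hxz'⟩
  have hyx := hxy'.resolve_right (notMem_of_lt _ (by omega))
  have hzy := hyz'.resolve_right (notMem_of_lt _ (by omega))
  have hzx := hxz'.resolve_right (notMem_of_lt _ (by omega))
  refine hsf _ hyx _ hzy ?_
  rwa [show y - x + (z - y) = z - x by omega]
end
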